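/- arXiv:1901.05380 — 4 statements merged into one kernel-verified Lean document; each statement's English description precedes it below -/
import Mathlib

section
/- Let 1 < β < 2 and set H := (3−β)/2. Then for all τ₁, τ₂ ≥ 0, ∫_0^∞ ∫_ℝ f_{τ₁}(x,s) f_{τ₂}(x,s) ds · x^{β−1} dx = (Γ(β−1) / (2(2−β)(3−β))) · (τ₁^{2H} + τ₂^{2H} − |τ₁ − τ₂|^{2H}). -/
open MeasureTheory Filter Set

/-- `f_τ(x,s) := ∫_0^τ e^{−x(t−s)} 1(s ≤ t) dt`. -/
noncomputable def fker (τ x s : ℝ) : ℝ :=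
  ∫ t in Set.Ioc (0:ℝ) τ, if s ≤ t then Real.exp (-x * (t - s)) else 0

lemma integral_exp_neg_mul_sub {x : ℝ} (hx : x ≠ 0) (s c d : ℝ) :
    ∫ t in c..d, Real.exp (-x * (t - s))
      = (Real.exp (-x * (c - s)) - Real.exp (-x * (d - s))) / x := by
  have hderiv : ∀ t ∈ uIcc c d,
      HasDerivAt (fun t => -Real.exp (-x * (t - s)) / x) (Real.exp (-x * (t - s))) t := by
    intro t _
    convert! ((((hasDerivAt_id t).sub_const s).const_mul (-x)).exp.neg.div_const x) using 1
    simp only [id]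
    field_simp
  rw [intervalIntegral.integral_eq_sub_of_hasDerivAt hderiv
    (Continuous.intervalIntegrable (by fun_prop) _ _)]
  ring

lemma integral_sub_mul_exp_neg {x : ℝ} (hx : x ≠ 0) (a : ℝ) :
    ∫ u in (0:ℝ)..a, (a - u) * Real.exp (-(u * x))
      = (Real.exp (-x * a) - 1 + x * a) / x ^ 2 := by
  have hderiv : ∀ u ∈ uIcc 0 a,
      HasDerivAt (fun u => -((a - u) * Real.exp (-(u * x))) / x + Real.exp (-(u * x)) / x ^ 2)
        ((a - u) * Real.exp (-(u * x))) u := by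
    intro u _
    have he : HasDerivAt (fun u => Real.exp (-(u * x))) (Real.exp (-(u * x)) * -(1 * x)) u :=
      (((hasDerivAt_id u).mul_const x).neg).exp
    convert! ((((hasDerivAt_id u).const_sub a).mul he).neg.div_const x).add
      (he.div_const (x ^ 2)) using 1
    simp only [id]
    field_simp
    ring
  rw [intervalIntegral.integral_eq_sub_of_hasDerivAt hderiv
    (Continuous.intervalIntegrable (by fun_prop) _ _)]
  simp only [zero_mul, neg_zero, Real.exp_zero, sub_self]
  rw [show -(a * x) = -x * a by ring]
  field_simp
  ring

lemma integral_one_sub_exp_sq {x : ℝ} (hx : x ≠ 0) (a : ℝ) :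
    ∫ s in (0:ℝ)..a, (1 - Real.exp (-x * (a - s))) ^ 2
      = a - 2 * (1 - Real.exp (-x * a)) / x + (1 - Real.exp (-x * a) ^ 2) / (2 * x) := by
  have hderiv : ∀ s ∈ uIcc 0 a,
      HasDerivAt (fun s => s - 2 * Real.exp (-x * (a - s)) / x
          + Real.exp (-x * (a - s)) ^ 2 / (2 * x))
        ((1 - Real.exp (-x * (a - s))) ^ 2) s := by
    intro s _
    have he : HasDerivAt (fun s => Real.exp (-x * (a - s)))
        (Real.exp (-x * (a - s)) * (-x * -1)) s :=
      (((hasDerivAt_id s).const_sub a).const_mul (-x)).exp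
    convert! (((hasDerivAt_id s).sub ((he.const_mul 2).div_const x))).add
      ((he.pow 2).div_const (2 * x)) using 1
    field_simp
    push_cast
    ring
  rw [intervalIntegral.integral_eq_sub_of_hasDerivAt hderiv
    (Continuous.intervalIntegrable (by fun_prop) _ _)]
  simp only [sub_self, mul_zero, Real.exp_zero, sub_zero]
  field_simp
  ring

lemma fker_of_nonpos {a x s : ℝ} (ha : 0 ≤ a) (hx : x ≠ 0) (hs : s ≤ 0) :
    fker a x s = Real.exp (x * s) * (1 - Real.exp (-x * a)) / x := by
  have h : fker a x s = ∫ t in (0:ℝ)..a, Real.exp (-x * (t - s)) := by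
    rw [intervalIntegral.integral_of_le ha]
    exact setIntegral_congr_fun measurableSet_Ioc fun t ht => if_pos (hs.trans ht.1.le)
  rw [h, integral_exp_neg_mul_sub hx, show -x * (0 - s) = x * s by ring,
    show -x * (a - s) = x * s + -x * a by ring, Real.exp_add]
  ring

lemma fker_of_mem_Ioc {a x s : ℝ} (hx : x ≠ 0) (hs : s ∈ Ioc 0 a) :
    fker a x s = (1 - Real.exp (-x * (a - s))) / x := by
  have h : fker a x s = ∫ t in s..a, Real.exp (-x * (t - s)) := by
    rw [intervalIntegral.integral_of_le hs.2, ← integral_Icc_eq_integral_Ioc, fker]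
    have hset : Ioc 0 a ∩ Ici s = Icc s a := by
      ext t
      simp only [mem_inter_iff, mem_Ioc, mem_Ici, mem_Icc]
      exact ⟨fun h => ⟨h.2, h.1.2⟩, fun h => ⟨⟨hs.1.trans_le h.1, h.2⟩, h.1⟩⟩
    rw [← hset, ← setIntegral_indicator measurableSet_Ici]
    rfl
  rw [h, integral_exp_neg_mul_sub hx, sub_self, mul_zero, Real.exp_zero]

lemma fker_of_lt {a x s : ℝ} (hs : a < s) : fker a x s = 0 := by
  rw [fker, setIntegral_congr_fun (g := fun _ => (0:ℝ)) measurableSet_Ioc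
    fun t ht => if_neg (not_le.2 (ht.2.trans_lt hs))]
  simp

lemma fker_sub_fker {a b : ℝ} (ha : 0 ≤ a) (hab : a ≤ b) (x s : ℝ) :
    fker b x s - fker a x s = fker (b - a) x (s - a) := by
  have hint : ∀ c d, IntervalIntegrable
      (fun t => if s ≤ t then Real.exp (-x * (t - s)) else 0) volume c d := by
    intro c d
    have hc : IntervalIntegrable (fun t => Real.exp (-x * (t - s))) volume c d :=
      Continuous.intervalIntegrable (by fun_prop) _ _
    exact ⟨hc.1.indicator (measurableSet_Ici (a := s)), hc.2.indicator (measurableSet_Ici (a := s))⟩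
  simp only [fker]
  rw [← intervalIntegral.integral_of_le ha, ← intervalIntegral.integral_of_le (ha.trans hab),
    ← intervalIntegral.integral_of_le (sub_nonneg.2 hab),
    intervalIntegral.integral_interval_sub_left (hint _ _) (hint _ _)]
  have := intervalIntegral.integral_comp_sub_right
    (fun t => if s - a ≤ t then Real.exp (-x * (t - (s - a))) else 0) (a := a) (b := b) a
  rw [sub_self] at this
  rw [← this]
  simp only [sub_le_sub_iff_right, sub_sub_sub_cancel_right]

lemma fker_sq_eq {a x : ℝ} (ha : 0 ≤ a) (hx : x ≠ 0) :
    (fun s => fker a x s ^ 2) = fun s =>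
      (Iic (0:ℝ)).indicator
        (fun s => Real.exp (2 * x * s) * ((1 - Real.exp (-x * a)) / x) ^ 2) s
      + (Ioc 0 a).indicator (fun s => (1 - Real.exp (-x * (a - s))) ^ 2 / x ^ 2) s := by
  funext s
  rcases le_or_gt s 0 with h0 | h0
  · rw [indicator_of_mem (by exact h0), indicator_of_notMem (by simp [h0]),
      fker_of_nonpos ha hx h0, show 2 * x * s = x * s + x * s by ring, Real.exp_add]
    ring
  rw [indicator_of_notMem (by simpa using h0), zero_add]
  rcases le_or_gt s a with h1 | h1
  · rw [indicator_of_mem (show s ∈ Ioc 0 a from ⟨h0, h1⟩), fker_of_mem_Ioc hx ⟨h0, h1⟩, div_pow]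
  · rw [indicator_of_notMem (by simp [h1]), fker_of_lt h1, zero_pow two_ne_zero]

lemma integrable_indicator_exp {x : ℝ} (hx : 0 < x) (c : ℝ) :
    Integrable ((Iic (0:ℝ)).indicator fun s => Real.exp (2 * x * s) * c) :=
  IntegrableOn.integrable_indicator
    ((integrableOn_exp_mul_Iic (by positivity : 0 < 2 * x) 0).mul_const c) measurableSet_Iic

lemma integrable_indicator_Ioc (a x : ℝ) :
    Integrable ((Ioc 0 a).indicator fun s => (1 - Real.exp (-x * (a - s))) ^ 2 / x ^ 2) := by
  refine IntegrableOn.integrable_indicator ?_ measurableSet_Ioc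
  exact (Continuous.integrableOn_Icc (by fun_prop)).mono_set Ioc_subset_Icc_self

lemma integrable_fker_sq {a x : ℝ} (ha : 0 ≤ a) (hx : 0 < x) :
    Integrable fun s => fker a x s ^ 2 := by
  rw [fker_sq_eq ha hx.ne']
  exact (integrable_indicator_exp hx _).add (integrable_indicator_Ioc a x)

lemma integral_fker_sq {a x : ℝ} (ha : 0 ≤ a) (hx : 0 < x) :
    ∫ s, fker a x s ^ 2 = (Real.exp (-x * a) - 1 + x * a) / x ^ 2 / x := by
  rw [fker_sq_eq ha hx.ne',
    integral_add (integrable_indicator_exp hx _) (integrable_indicator_Ioc a x),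
    integral_indicator measurableSet_Iic, integral_indicator measurableSet_Ioc,
    integral_mul_const, integral_div, integral_exp_mul_Iic (by positivity),
    ← intervalIntegral.integral_of_le ha, integral_one_sub_exp_sq hx.ne']
  simp only [mul_zero, Real.exp_zero]
  field_simp
  ring

lemma integral_fker_mul_fker {a b x : ℝ} (ha : 0 ≤ a) (hab : a ≤ b) (hx : 0 < x) :
    ∫ s, fker a x s * fker b x s
      = ((∫ s, fker a x s ^ 2) + (∫ s, fker b x s ^ 2) - ∫ s, fker (b - a) x s ^ 2) / 2 := by
  have hpol : ∀ s, fker a x s * fker b x s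
      = (fker a x s ^ 2 + fker b x s ^ 2 - fker (b - a) x (s - a) ^ 2) / 2 := by
    intro s
    rw [← fker_sub_fker ha hab]
    ring
  have hA := integrable_fker_sq ha hx
  have hB := integrable_fker_sq (ha.trans hab) hx
  have hC := (integrable_fker_sq (sub_nonneg.2 hab) hx).comp_sub_right a
  simp_rw [hpol]
  rw [integral_div, integral_sub (by exact hA.add hB) hC, integral_add hA hB,
    integral_sub_right_eq_self (fun s => fker (b - a) x s ^ 2) a]

lemma integrableOn_rpow_mul_exp_neg_mul_Ioi {p r : ℝ} (hp : -1 < p) (hr : 0 < r) :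
    IntegrableOn (fun x : ℝ => x ^ p * Real.exp (-(r * x))) (Ioi 0) := by
  simpa using integrableOn_rpow_mul_exp_neg_mul_rpow hp one_pos hr

lemma integral_rpow_mul_sub_mul_exp {β a u : ℝ} (hβ : 1 < β) (hu : 0 < u) :
    ∫ x in Ioi (0:ℝ), x ^ (β - 2) * ((a - u) * Real.exp (-(u * x)))
      = Real.Gamma (β - 1) * (a * u ^ (1 - β) - u ^ (2 - β)) := by
  have h := Real.integral_rpow_mul_exp_neg_mul_Ioi (sub_pos.2 hβ) hu
  rw [show β - 1 - 1 = β - 2 by ring, one_div, Real.inv_rpow hu.le, ← Real.rpow_neg hu.le,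
    neg_sub] at h
  simp_rw [mul_left_comm _ (a - u)]
  rw [integral_const_mul, h, show 2 - β = 1 - β + 1 by ring, Real.rpow_add_one hu.ne']
  ring

lemma intervalIntegrable_mul_rpow_sub_rpow {β : ℝ} (hβ : β < 2) (a b : ℝ) :
    IntervalIntegrable (fun u : ℝ => a * u ^ (1 - β) - u ^ (2 - β)) volume 0 b :=
  ((intervalIntegral.intervalIntegrable_rpow' (by linarith)).const_mul a).sub
    (intervalIntegral.intervalIntegrable_rpow' (by linarith))

lemma integrable_rpow_mul_sub_mul_exp {β a : ℝ} (hβ1 : 1 < β) (hβ2 : β < 2) (ha : 0 ≤ a) :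
    Integrable (Function.uncurry fun x u : ℝ => x ^ (β - 2) * ((a - u) * Real.exp (-(u * x))))
      ((volume.restrict (Ioi 0)).prod (volume.restrict (Ioc 0 a))) := by
  rw [integrable_prod_iff' (Measurable.aestronglyMeasurable (by
    unfold Function.uncurry; fun_prop))]
  simp only [Function.uncurry]
  constructor
  · filter_upwards [ae_restrict_mem measurableSet_Ioc] with u hu
    simp_rw [mul_left_comm _ (a - u)]
    exact (integrableOn_rpow_mul_exp_neg_mul_Ioi (by linarith) hu.1).const_mul _
  · have hI := ((intervalIntegrable_iff_integrableOn_Ioc_of_le ha).1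
      (intervalIntegrable_mul_rpow_sub_rpow hβ2 a a)).const_mul (Real.Gamma (β - 1))
    refine hI.congr ?_
    filter_upwards [ae_restrict_mem measurableSet_Ioc] with u hu
    rw [← integral_rpow_mul_sub_mul_exp hβ1 hu.1]
    refine setIntegral_congr_fun measurableSet_Ioi fun x hx => ?_
    exact (Real.norm_of_nonneg (mul_nonneg (Real.rpow_nonneg (le_of_lt hx) _)
      (mul_nonneg (sub_nonneg.2 hu.2) (Real.exp_nonneg _)))).symm

lemma integral_fker_sq_mul_rpow {β a x : ℝ} (ha : 0 ≤ a) (hx : 0 < x) :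
    (∫ s, fker a x s ^ 2) * x ^ (β - 1)
      = ∫ u in Ioc 0 a, x ^ (β - 2) * ((a - u) * Real.exp (-(u * x))) := by
  rw [integral_const_mul, ← intervalIntegral.integral_of_le ha, integral_sub_mul_exp_neg hx.ne',
    integral_fker_sq ha hx, show β - 1 = β - 2 + 1 by ring, Real.rpow_add_one hx.ne']
  field_simp

lemma integrableOn_integral_fker_sq {β a : ℝ} (hβ1 : 1 < β) (hβ2 : β < 2) (ha : 0 ≤ a) :
    IntegrableOn (fun x => (∫ s, fker a x s ^ 2) * x ^ (β - 1)) (Ioi 0) :=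
  (integrable_rpow_mul_sub_mul_exp hβ1 hβ2 ha).integral_prod_left.congr
    ((ae_restrict_mem measurableSet_Ioi).mono fun _ hx => (integral_fker_sq_mul_rpow ha hx).symm)

lemma integral_integral_fker_sq {β a : ℝ} (hβ1 : 1 < β) (hβ2 : β < 2) (ha : 0 ≤ a) :
    ∫ x in Ioi (0:ℝ), (∫ s, fker a x s ^ 2) * x ^ (β - 1)
      = Real.Gamma (β - 1) / ((2 - β) * (3 - β)) * a ^ (3 - β) := by
  have h2 : 2 - β ≠ 0 := by linarith
  have h3 : 3 - β ≠ 0 := by linarith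
  rw [setIntegral_congr_fun measurableSet_Ioi fun x hx => integral_fker_sq_mul_rpow ha hx,
    integral_integral_swap (integrable_rpow_mul_sub_mul_exp hβ1 hβ2 ha),
    setIntegral_congr_fun measurableSet_Ioc fun u hu => integral_rpow_mul_sub_mul_exp hβ1 hu.1,
    integral_const_mul, ← intervalIntegral.integral_of_le ha,
    intervalIntegral.integral_sub
      ((intervalIntegral.intervalIntegrable_rpow' (by linarith)).const_mul a)
      (intervalIntegral.intervalIntegrable_rpow' (by linarith)),
    intervalIntegral.integral_const_mul, integral_rpow (Or.inl (by linarith)),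
    integral_rpow (Or.inl (by linarith)), show 1 - β + 1 = 2 - β by ring,
    show 2 - β + 1 = 3 - β by ring, Real.zero_rpow h2, Real.zero_rpow h3]
  have hpow : a ^ (3 - β) = a * a ^ (2 - β) := by
    rw [show 3 - β = 1 + (2 - β) by ring, Real.rpow_add' ha (by linarith), Real.rpow_one]
  rw [hpow]
  field_simp
  ring

lemma integral_covariance_of_le {β a b : ℝ} (hβ1 : 1 < β) (hβ2 : β < 2) (ha : 0 ≤ a)
    (hab : a ≤ b) :
    (∫ x in Ioi (0:ℝ), (∫ s, fker a x s * fker b x s) * x ^ (β - 1))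
      = (Real.Gamma (β - 1) / (2 * (2 - β) * (3 - β)))
        * (a ^ (3 - β) + b ^ (3 - β) - (b - a) ^ (3 - β)) := by
  have hA := integrableOn_integral_fker_sq hβ1 hβ2 ha
  have hB := integrableOn_integral_fker_sq hβ1 hβ2 (ha.trans hab)
  have hC := integrableOn_integral_fker_sq hβ1 hβ2 (sub_nonneg.2 hab)
  have hpol : ∀ x ∈ Ioi (0:ℝ), (∫ s, fker a x s * fker b x s) * x ^ (β - 1)
      = ((∫ s, fker a x s ^ 2) * x ^ (β - 1) + (∫ s, fker b x s ^ 2) * x ^ (β - 1)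
        - (∫ s, fker (b - a) x s ^ 2) * x ^ (β - 1)) / 2 := by
    intro x hx
    rw [integral_fker_mul_fker ha hab hx]
    ring
  rw [setIntegral_congr_fun measurableSet_Ioi hpol, integral_div,
    integral_sub (by exact hA.add hB) hC, integral_add hA hB, integral_integral_fker_sq hβ1 hβ2 ha,
    integral_integral_fker_sq hβ1 hβ2 (ha.trans hab),
    integral_integral_fker_sq hβ1 hβ2 (sub_nonneg.2 hab)]
  have h2 : 2 - β ≠ 0 := by linarith
  have h3 : 3 - β ≠ 0 := by linarith
  field_simp

/-- the covariance identity showing that `Λ_{2,β}` is a fractional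
Brownian motion with Hurst index `H = (3−β)/2` (up to the factor `ψ₁ E ε²`). -/
theorem stmt_3 (β : ℝ) (hβ1 : 1 < β) (hβ2 : β < 2) (τ₁ τ₂ : ℝ) (hτ₁ : 0 ≤ τ₁) (hτ₂ : 0 ≤ τ₂) :
    (∫ x in Set.Ioi (0:ℝ), (∫ s : ℝ, fker τ₁ x s * fker τ₂ x s) * x ^ (β - 1))
      = (Real.Gamma (β - 1) / (2 * (2 - β) * (3 - β)))
        * (τ₁ ^ (2 * ((3 - β) / 2)) + τ₂ ^ (2 * ((3 - β) / 2))
            - |τ₁ - τ₂| ^ (2 * ((3 - β) / 2))) := by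
  have hH : 2 * ((3 - β) / 2) = 3 - β := by ring
  rw [hH]
  rcases le_total τ₁ τ₂ with h | h
  · rw [abs_sub_comm, abs_of_nonneg (sub_nonneg.2 h)]
    exact integral_covariance_of_le hβ1 hβ2 hτ₁ h
  · rw [abs_of_nonneg (sub_nonneg.2 h), add_comm (τ₁ ^ (3 - β)),
      ← integral_covariance_of_le hβ1 hβ2 hτ₂ h]
    simp only [mul_comm (fker τ₁ _ _)]
end

section
/- Let 0 < α ≤ 2, a ∈ [0,1) and τ > 0. Then lim_{n→∞} n^{−1} Σ_{s ∈ ℤ} |c_{⌊nτ⌋}(a,s)|^α = τ (1−a)^{−α}. -/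
open MeasureTheory Filter Set

/-- `c_n(a,s) := Σ_{t=1}^n a^{t−s} 1(s ≤ t)` for `a ∈ [0,1)`, `n ∈ ℕ`, `s ∈ ℤ`. -/
noncomputable def cAR (n : ℕ) (a : ℝ) (s : ℤ) : ℝ :=
  ∑ t ∈ Finset.Icc 1 n, if s ≤ (t : ℤ) then a ^ ((t : ℤ) - s).toNat else 0

theorem cAR_of_lt (n : ℕ) (a : ℝ) {s : ℤ} (hs : (n : ℤ) < s) : cAR n a s = 0 := by
  refine Finset.sum_eq_zero fun t ht => if_neg ?_
  have := (Finset.mem_Icc.1 ht).2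
  omega

theorem cAR_sub_of_lt (a : ℝ) {n k : ℕ} (hk : k < n) :
    cAR n a ((n : ℤ) - k) = ∑ j ∈ Finset.range (k + 1), a ^ j := by
  unfold cAR
  rw [← Finset.sum_filter]
  refine Finset.sum_nbij' (fun t => k + t - n) (fun j => n - k + j) ?_ ?_ ?_ ?_ ?_
  · intro t ht
    simp only [Finset.mem_filter, Finset.mem_Icc, Finset.mem_range] at ht ⊢
    omega
  · intro j hj
    simp only [Finset.mem_filter, Finset.mem_Icc, Finset.mem_range] at hj ⊢
    omega
  · intro t ht
    simp only [Finset.mem_filter, Finset.mem_Icc] at ht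
    omega
  · intro j _
    omega
  · intro t ht
    simp only [Finset.mem_filter, Finset.mem_Icc] at ht
    congr 1
    omega

theorem cAR_neg_natCast (n : ℕ) (a : ℝ) (m : ℕ) :
    cAR n a (-(m : ℤ)) = a ^ (m + 1) * ∑ j ∈ Finset.range n, a ^ j := by
  unfold cAR
  rw [Finset.mul_sum, Finset.range_eq_Ico, ← Finset.Ico_add_one_right_eq_Icc,
    ← Finset.sum_Ico_add' _ 0 n 1]
  refine Finset.sum_congr rfl fun j _ => ?_
  rw [if_pos (by omega), ← pow_add]
  congr 1
  omega

/-- Closed form of the series: the terms with `1 ≤ s ≤ n` give the finite sum, and the terms with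
`s ≤ 0` form a geometric series of ratio `a ^ α`. -/
theorem hasSum_abs_cAR_rpow {α a : ℝ} (hα : 0 < α) (ha0 : 0 ≤ a) (ha1 : a < 1) (n : ℕ) :
    HasSum (fun s : ℤ => |cAR n a s| ^ α)
      ((∑ j ∈ Finset.range n, a ^ j) ^ α * (a ^ α * (1 - a ^ α)⁻¹) +
        ∑ k ∈ Finset.range n, (∑ j ∈ Finset.range (k + 1), a ^ j) ^ α) := by
  have hp : ∀ k : ℕ, 0 ≤ ∑ j ∈ Finset.range k, a ^ j := fun k =>
    Finset.sum_nonneg fun j _ => pow_nonneg ha0 j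
  have hinj : Function.Injective fun k : ℕ => (n : ℤ) - k := fun k l h => by
    simpa using h
  rw [← hinj.hasSum_iff]
  · have hfin : ∑ k ∈ Finset.range n, (∑ j ∈ Finset.range (k + 1), a ^ j) ^ α =
        ∑ k ∈ Finset.range n, ((fun s : ℤ => |cAR n a s| ^ α) ∘ fun k : ℕ => (n : ℤ) - k) k := by
      refine Finset.sum_congr rfl fun k hk => ?_
      simp only [Function.comp_apply]
      rw [cAR_sub_of_lt a (Finset.mem_range.1 hk), abs_of_nonneg (hp _)]
    rw [hfin, ← hasSum_nat_add_iff n]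
    have hgeom := ((hasSum_geometric_of_lt_one (Real.rpow_nonneg ha0 α)
      (Real.rpow_lt_one ha0 ha1 hα)).mul_left (a ^ α)).mul_left
        ((∑ j ∈ Finset.range n, a ^ j) ^ α)
    refine hgeom.congr_fun fun m => ?_
    have hs : (n : ℤ) - ((m + n : ℕ) : ℤ) = -(m : ℤ) := by
      push_cast
      ring
    simp only [Function.comp_apply]
    rw [hs, cAR_neg_natCast, abs_of_nonneg (mul_nonneg (pow_nonneg ha0 _) (hp n)),
      Real.mul_rpow (pow_nonneg ha0 _) (hp n), ← Real.rpow_natCast_mul ha0, mul_comm _ α,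
      Real.rpow_mul_natCast ha0]
    ring
  · intro s hs
    have hlt : (n : ℤ) < s := by
      by_contra! h
      exact hs ⟨((n : ℤ) - s).toNat, by simp only; omega⟩
    simp only [cAR_of_lt n a hlt, abs_zero, Real.zero_rpow hα.ne']

theorem tendsto_geom_sum_rpow {α a : ℝ} (hα : 0 < α) (ha0 : 0 ≤ a) (ha1 : a < 1) :
    Tendsto (fun n : ℕ => (∑ j ∈ Finset.range n, a ^ j) ^ α) atTop (nhds ((1 - a) ^ (-α))) := by
  rw [Real.rpow_neg (by linarith), ← Real.inv_rpow (by linarith)]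
  exact (hasSum_geometric_of_lt_one ha0 ha1).tendsto_sum_nat.rpow_const (Or.inr hα.le)

theorem tendsto_inv_mul_tsum_abs_cAR_rpow {α a : ℝ} (hα : 0 < α) (ha0 : 0 ≤ a) (ha1 : a < 1) :
    Tendsto (fun n : ℕ => (n : ℝ)⁻¹ * ∑' s : ℤ, |cAR n a s| ^ α) atTop
      (nhds ((1 - a) ^ (-α))) := by
  have hp := tendsto_geom_sum_rpow hα ha0 ha1
  have hces := ((tendsto_add_atTop_iff_nat 1).2 hp).cesaro
  have hbdd := (tendsto_inv_atTop_nhds_zero_nat (𝕜 := ℝ)).mul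
    (hp.mul_const (a ^ α * (1 - a ^ α)⁻¹))
  simpa only [(hasSum_abs_cAR_rpow hα ha0 ha1 _).tsum_eq, mul_add, zero_mul, zero_add]
    using hbdd.add hces

/-- `lim_{n→∞} n^{−1} Σ_{s ∈ ℤ} |c_{⌊nτ⌋}(a,s)|^α = τ (1−a)^{−α}`,
the analytic core of the conditional convergence (4.6). -/
theorem stmt_6 (α : ℝ) (hα0 : 0 < α) (hα2 : α ≤ 2) (a : ℝ) (ha0 : 0 ≤ a) (ha1 : a < 1)
    (τ : ℝ) (hτ : 0 < τ) :
    Filter.Tendsto (fun n : ℕ => (n : ℝ)⁻¹ * ∑' s : ℤ, |cAR ⌊(n : ℝ) * τ⌋₊ a s| ^ α)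
      Filter.atTop (nhds (τ * (1 - a) ^ (-α))) := by
  have hfloor : Tendsto (fun n : ℕ => ⌊(n : ℝ) * τ⌋₊) atTop atTop :=
    tendsto_nat_floor_atTop.comp (tendsto_natCast_atTop_atTop.atTop_mul_const hτ)
  have hratio : Tendsto (fun n : ℕ => (⌊(n : ℝ) * τ⌋₊ : ℝ) / n) atTop (nhds τ) := by
    simpa only [Function.comp_def, mul_comm τ] using
      (tendsto_nat_floor_mul_div_atTop hτ.le).comp (tendsto_natCast_atTop_atTop (R := ℝ))
  refine (hratio.mul ((tendsto_inv_mul_tsum_abs_cAR_rpow hα0 ha0 ha1).comp hfloor)).congr' ?_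
  filter_upwards [hfloor.eventually_ne_atTop 0] with n hn
  have hN : (⌊(n : ℝ) * τ⌋₊ : ℝ) ≠ 0 := Nat.cast_ne_zero.2 hn
  simp only [Function.comp_apply]
  field_simp
end

section
/- Let 0 < β < α ≤ 2, let ψ: [0,1) → [0,∞) be integrable with lim_{u↑1} ψ(u) = ψ₁ > 0, and set φ(u) := ψ(u)(1−u)^{β−1} for u ∈ [0,1). Then for every r > 0, lim_{N→∞} N ∫_0^1 (exp(−N^{−α/β} (1−u)^{−α} r) − 1) φ(u) du = −(ψ₁ Γ(1 − β/α)/β) · r^{β/α}. -/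
open MeasureTheory Filter Set

theorem abs_exp_neg_sub_one_le {x : ℝ} (hx : 0 ≤ x) : |Real.exp (-x) - 1| ≤ x := by
  have h1 : Real.exp (-x) ≤ 1 := Real.exp_le_one_iff.2 (by linarith)
  have h2 := Real.add_one_le_exp (-x)
  rw [abs_of_nonpos (by linarith)]
  linarith

theorem abs_exp_neg_sub_one_le_one {x : ℝ} (hx : 0 ≤ x) : |Real.exp (-x) - 1| ≤ 1 := by
  have h1 : Real.exp (-x) ≤ 1 := Real.exp_le_one_iff.2 (by linarith)
  have h2 := Real.exp_pos (-x)
  rw [abs_of_nonpos (by linarith)]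
  linarith

theorem integrableOn_exp_neg_rpow_neg_sub_one {γ r : ℝ} (hγ : 1 < γ) (hr : 0 < r) :
    IntegrableOn (fun x : ℝ => Real.exp (-(x ^ (-γ) * r)) - 1) (Ioi 0) := by
  have hm : Measurable (fun x : ℝ => Real.exp (-(x ^ (-γ) * r)) - 1) := by fun_prop
  rw [← Ioc_union_Ioi_eq_Ioi zero_le_one]
  refine IntegrableOn.union ?_ ?_
  · refine Integrable.mono' (g := fun _ => (1 : ℝ)) (integrableOn_const (by simp))
      hm.aestronglyMeasurable ?_
    refine (ae_restrict_mem measurableSet_Ioc).mono fun x hx => ?_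
    have := Real.rpow_pos_of_pos hx.1 (-γ)
    exact abs_exp_neg_sub_one_le_one (by positivity)
  · refine Integrable.mono' (g := fun x : ℝ => x ^ (-γ) * r)
      ((integrableOn_Ioi_rpow_of_lt (by linarith) one_pos).mul_const r)
      hm.aestronglyMeasurable ?_
    refine (ae_restrict_mem measurableSet_Ioi).mono fun x hx => ?_
    have := Real.rpow_pos_of_pos (one_pos.trans hx) (-γ)
    exact abs_exp_neg_sub_one_le (by positivity)

theorem rpow_neg_two_mul_rpow_neg_one_mul {γ r x : ℝ} (hx : 0 < x) :
    x ^ ((-1 : ℝ) - 1) * ((x ^ (-1 : ℝ)) ^ (-γ) * Real.exp (-((x ^ (-1 : ℝ)) ^ (-γ) * r))) =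
      x ^ (γ - 2) * Real.exp (-r * x ^ γ) := by
  have h1 : (x ^ (-1 : ℝ)) ^ (-γ) = x ^ γ := by
    rw [← Real.rpow_mul hx.le]; congr 1; ring
  rw [h1, ← mul_assoc, ← Real.rpow_add hx]
  congr 2 <;> ring

theorem integrableOn_rpow_neg_mul_exp_neg_rpow_neg {γ r : ℝ} (hγ : 1 < γ) (hr : 0 < r) :
    IntegrableOn (fun x : ℝ => x ^ (-γ) * Real.exp (-(x ^ (-γ) * r))) (Ioi 0) := by
  rw [← integrableOn_Ioi_comp_rpow_iff' _ (p := -1) (by norm_num)]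
  refine (integrableOn_rpow_mul_exp_neg_mul_rpow (s := γ - 2) (p := γ) (b := r)
    (by linarith) (by linarith) hr).congr_fun (fun x hx => ?_) measurableSet_Ioi
  rw [smul_eq_mul, rpow_neg_two_mul_rpow_neg_one_mul hx]

theorem integral_rpow_neg_mul_exp_neg_rpow_neg {γ r : ℝ} (hγ : 1 < γ) (hr : 0 < r) :
    ∫ x in Ioi (0 : ℝ), x ^ (-γ) * Real.exp (-(x ^ (-γ) * r)) =
      r ^ (-(γ - 1) / γ) * (1 / γ) * Real.Gamma ((γ - 1) / γ) := by
  rw [← integral_comp_rpow_Ioi _ (p := -1) (by norm_num)]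
  have h := integral_rpow_mul_exp_neg_mul_rpow (p := γ) (q := γ - 2) (b := r)
    (by linarith) (by linarith) hr
  rw [show γ - 2 + 1 = γ - 1 by ring] at h
  rw [← h]
  refine setIntegral_congr_fun measurableSet_Ioi fun x hx => ?_
  simp only [abs_neg, abs_one, one_mul, smul_eq_mul]
  exact rpow_neg_two_mul_rpow_neg_one_mul hx

theorem integral_exp_neg_rpow_neg_sub_one {γ r : ℝ} (hγ : 1 < γ) (hr : 0 < r) :
    ∫ x in Ioi (0 : ℝ), (Real.exp (-(x ^ (-γ) * r)) - 1) =
      -(Real.Gamma (1 - 1 / γ) * r ^ (1 / γ)) := by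
  have hγ0 : 0 < γ := by linarith
  have hi1 := integrableOn_exp_neg_rpow_neg_sub_one hγ hr
  have hi2 := (integrableOn_rpow_neg_mul_exp_neg_rpow_neg hγ hr).const_mul (r * γ)
  have hb : ∀ x : ℝ, 0 < x → 0 ≤ x ^ (-γ) * r := fun x hx =>
    mul_nonneg (Real.rpow_nonneg hx.le _) hr.le
  have key := integral_Ioi_of_hasDerivAt_of_tendsto (a := 0) (m := 0)
    (f := fun x : ℝ => x * (Real.exp (-(x ^ (-γ) * r)) - 1))
    (f' := fun x : ℝ => (Real.exp (-(x ^ (-γ) * r)) - 1) +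
      r * γ * (x ^ (-γ) * Real.exp (-(x ^ (-γ) * r)))) ?_ ?_ (hi1.add hi2) ?_
  · rw [integral_add hi1 hi2, integral_const_mul,
      integral_rpow_neg_mul_exp_neg_rpow_neg hγ hr] at key
    have e1 : (γ - 1) / γ = 1 - 1 / γ := by field_simp
    have e2 : r * r ^ (-(γ - 1) / γ) = r ^ (1 / γ) := by
      rw [← Real.rpow_one_add' hr.le] <;> rw [neg_div, e1]
      · congr 1; ring
      · have : 0 < 1 / γ := by positivity
        linarith
    rw [e1] at key
    rw [← e2]
    have e3 : r * γ * (r ^ (-(γ - 1) / γ) * (1 / γ) * Real.Gamma (1 - 1 / γ)) =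
      Real.Gamma (1 - 1 / γ) * (r * r ^ (-(γ - 1) / γ)) := by field_simp
    rw [e3] at key
    simp only [zero_mul, sub_zero] at key
    linarith
  · rw [ContinuousWithinAt, zero_mul]
    refine squeeze_zero_norm' (a := fun x : ℝ => x) ?_
      (tendsto_id.mono_left nhdsWithin_le_nhds)
    refine eventually_nhdsWithin_of_forall fun x hx => ?_
    rw [mem_Ici] at hx
    have h0 : 0 ≤ x ^ (-γ) * r := mul_nonneg (Real.rpow_nonneg hx _) hr.le
    rw [norm_mul, Real.norm_of_nonneg hx]
    exact mul_le_of_le_one_right hx (abs_exp_neg_sub_one_le_one h0)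
  · intro x hx
    have hx' : 0 < x := hx
    have h1 := (((Real.hasDerivAt_rpow_const (x := x) (p := -γ) (Or.inl hx'.ne')).mul_const
      r).neg.exp.sub_const 1)
    refine ((hasDerivAt_id x).mul h1).congr_deriv ?_
    have : x ^ (-γ) = x * x ^ (-γ - 1) := by
      rw [← Real.rpow_one_add' hx'.le (by linarith)]; congr 1; ring
    simp only [id, Pi.neg_apply]
    rw [this]
    ring
  · have hz : Tendsto (fun x : ℝ => r * x ^ (-(γ - 1))) atTop (nhds 0) := by
      simpa using (tendsto_rpow_neg_atTop (y := γ - 1) (by linarith)).const_mul r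
    refine squeeze_zero_norm' ?_ hz
    filter_upwards [eventually_gt_atTop 0] with x hx
    have : x ^ (-(γ - 1)) = x * x ^ (-γ) := by
      rw [← Real.rpow_one_add' hx.le (by linarith)]; congr 1; ring
    rw [norm_mul, Real.norm_of_nonneg hx.le, this]
    calc x * ‖Real.exp (-(x ^ (-γ) * r)) - 1‖ ≤ x * (x ^ (-γ) * r) :=
          mul_le_mul_of_nonneg_left (abs_exp_neg_sub_one_le (hb x hx)) hx.le
      _ = _ := by ring

theorem aestronglyMeasurable_exp_neg_mul_rpow_sub_one (c a r : ℝ) (s : Set ℝ) :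
    AEStronglyMeasurable (fun w : ℝ => Real.exp (-(c * w ^ a * r)) - 1)
      (volume.restrict s) :=
  Measurable.aestronglyMeasurable (by fun_prop)

theorem integrableOn_exp_neg_mul_rpow_sub_one_mul {c a r : ℝ} (hc : 0 ≤ c) (hr : 0 ≤ r)
    {f : ℝ → ℝ} {s : Set ℝ} (hs : MeasurableSet s) (hs0 : s ⊆ Ioi 0) (hf : IntegrableOn f s) :
    IntegrableOn (fun w : ℝ => (Real.exp (-(c * w ^ a * r)) - 1) * f w) s := by
  refine hf.bdd_mul (c := 1) (aestronglyMeasurable_exp_neg_mul_rpow_sub_one c a r s) ?_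
  refine (ae_restrict_mem hs).mono fun w hw => ?_
  have := Real.rpow_nonneg (le_of_lt (hs0 hw)) a
  exact abs_exp_neg_sub_one_le_one (by positivity)

theorem tendsto_nat_mul_integral_exp_neg_sub_one_mul_of_bounded {α β r ψ₁ C : ℝ}
    (hβ : 0 < β) (hβα : β < α) (hr : 0 < r) {G : ℝ → ℝ}
    (hGC : ∀ w, 0 < w → |G w| ≤ C)
    (hG : Tendsto G (nhdsWithin 0 (Ioi 0)) (nhds ψ₁))
    (hGi : IntegrableOn (fun w => G w * w ^ (β - 1)) (Ioi 0)) :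
    Tendsto (fun N : ℕ => (N : ℝ) * ∫ w in Ioi (0 : ℝ),
        (Real.exp (-((N : ℝ) ^ (-(α / β)) * w ^ (-α) * r)) - 1) * (G w * w ^ (β - 1)))
      atTop (nhds (-(ψ₁ * Real.Gamma (1 - β / α) / β) * r ^ (β / α))) := by
  have hγ : 1 < α / β := (one_lt_div hβ).2 hβα
  set H : ℕ → ℝ → ℝ := fun N x =>
    (Real.exp (-(x ^ (-(α / β)) * r)) - 1) * G ((x / N) ^ β⁻¹) with hH
  have hpt : ∀ N : ℕ, 0 < N → ∀ w ∈ Ioi (0 : ℝ),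
      (Real.exp (-((N : ℝ) ^ (-(α / β)) * w ^ (-α) * r)) - 1) * (G w * w ^ (β - 1)) =
        w ^ (β - 1) • H N (N * w ^ β) := by
    intro N hN w hw
    have hw : 0 < w := hw
    have hN : (0 : ℝ) < N := by exact_mod_cast hN
    have e1 : ((N : ℝ) * w ^ β) ^ (-(α / β)) = (N : ℝ) ^ (-(α / β)) * w ^ (-α) := by
      rw [Real.mul_rpow hN.le (Real.rpow_nonneg hw.le _), ← Real.rpow_mul hw.le]
      congr 2; field_simp
    have e2 : ((N : ℝ) * w ^ β / N) ^ β⁻¹ = w := by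
      rw [mul_div_cancel_left₀ _ hN.ne', ← Real.rpow_mul hw.le, mul_inv_cancel₀ hβ.ne',
        Real.rpow_one]
    simp only [hH, e1, e2, smul_eq_mul]
    ring
  have hint : ∀ N : ℕ, 0 < N → IntegrableOn (H N) (Ioi 0) := by
    intro N hN
    have hN' : (0 : ℝ) < N := by exact_mod_cast hN
    have h1 := integrableOn_exp_neg_mul_rpow_sub_one_mul (a := -α)
      (Real.rpow_nonneg hN'.le (-(α / β))) hr.le measurableSet_Ioi subset_rfl hGi
    have h2 := h1.congr_fun (hpt N hN) measurableSet_Ioi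
    rw [integrableOn_Ioi_comp_rpow_iff' (fun y => H N (N * y)) hβ.ne',
      integrableOn_Ioi_comp_mul_left_iff (H N) 0 hN', mul_zero] at h2
    exact h2
  have hval : ∀ N : ℕ, 0 < N → (N : ℝ) * ∫ w in Ioi (0 : ℝ),
      (Real.exp (-((N : ℝ) ^ (-(α / β)) * w ^ (-α) * r)) - 1) * (G w * w ^ (β - 1)) =
        β⁻¹ * ∫ x in Ioi (0 : ℝ), H N x := by
    intro N hN
    have hN' : (0 : ℝ) < N := by exact_mod_cast hN
    rw [setIntegral_congr_fun measurableSet_Ioi (hpt N hN)]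
    have h1 := integral_comp_rpow_Ioi_of_pos (g := fun y => H N (N * y)) hβ
    have h2 := integral_comp_mul_left_Ioi' (H N) 0 hN'
    rw [mul_zero] at h2
    simp only [smul_eq_mul, mul_assoc, integral_const_mul] at h1 h2 ⊢
    rw [← h2, ← h1]
    field_simp
  have hlim : Tendsto (fun N : ℕ => ∫ x in Ioi (0 : ℝ), H N x) atTop
      (nhds (∫ x in Ioi (0 : ℝ), (Real.exp (-(x ^ (-(α / β)) * r)) - 1) * ψ₁)) := by
    refine tendsto_integral_filter_of_dominated_convergence
      (fun x => ‖Real.exp (-(x ^ (-(α / β)) * r)) - 1‖ * C) ?_ ?_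
      ((integrableOn_exp_neg_rpow_neg_sub_one hγ hr).norm.mul_const C) ?_
    · filter_upwards [eventually_gt_atTop 0] with N hN
      exact (hint N hN).aestronglyMeasurable
    · filter_upwards [eventually_gt_atTop 0] with N hN
      refine (ae_restrict_mem measurableSet_Ioi).mono fun x hx => ?_
      have hx : 0 < x := hx
      have hN' : (0 : ℝ) < N := by exact_mod_cast hN
      rw [norm_mul]
      exact mul_le_mul_of_nonneg_left (hGC _ (by positivity)) (norm_nonneg _)
    · refine (ae_restrict_mem measurableSet_Ioi).mono fun x hx => ?_
      have hx : 0 < x := hx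
      refine Tendsto.const_mul _ (hG.comp (tendsto_nhdsWithin_iff.2 ⟨?_, ?_⟩))
      · have := (tendsto_const_div_atTop_nhds_zero_nat x).rpow_const (p := β⁻¹)
          (Or.inr (inv_nonneg.2 hβ.le))
        rwa [Real.zero_rpow (inv_ne_zero hβ.ne')] at this
      · filter_upwards [eventually_gt_atTop 0] with N hN
        have hN' : (0 : ℝ) < N := by exact_mod_cast hN
        exact Real.rpow_pos_of_pos (div_pos hx hN') _
  rw [integral_mul_const, integral_exp_neg_rpow_neg_sub_one hγ hr, one_div_div] at hlim
  have hfin := (hlim.const_mul β⁻¹).congr' (f₂ := fun N : ℕ => (N : ℝ) * ∫ w in Ioi (0 : ℝ),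
        (Real.exp (-((N : ℝ) ^ (-(α / β)) * w ^ (-α) * r)) - 1) * (G w * w ^ (β - 1)))
    (by filter_upwards [eventually_gt_atTop 0] with N hN using (hval N hN).symm)
  convert hfin using 2
  field_simp

theorem tendsto_nat_mul_integral_exp_neg_sub_one_mul_zero {α β r : ℝ}
    (hβ : 0 < β) (hβα : β < α) (hr : 0 < r) {f : ℝ → ℝ} {s : Set ℝ} (hs : MeasurableSet s)
    (hs0 : s ⊆ Ioi 0) (hf : IntegrableOn (fun w => f w * w ^ (-α)) s) :
    Tendsto (fun N : ℕ => (N : ℝ) * ∫ w in s,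
        (Real.exp (-((N : ℝ) ^ (-(α / β)) * w ^ (-α) * r)) - 1) * f w)
      atTop (nhds 0) := by
  have hγ : 1 < α / β := (one_lt_div hβ).2 hβα
  have hz : Tendsto (fun N : ℕ => (N : ℝ) ^ (-(α / β - 1)) *
      (r * ∫ w in s, ‖f w * w ^ (-α)‖)) atTop (nhds 0) := by
    simpa using ((tendsto_rpow_neg_atTop (y := α / β - 1) (by linarith)).comp
      tendsto_natCast_atTop_atTop).mul_const (r * ∫ w in s, ‖f w * w ^ (-α)‖)
  refine squeeze_zero_norm' ?_ hz
  filter_upwards [eventually_gt_atTop 0] with N hN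
  have hN' : (0 : ℝ) < N := by exact_mod_cast hN
  have e : (N : ℝ) ^ (-(α / β - 1)) = N * (N : ℝ) ^ (-(α / β)) := by
    rw [← Real.rpow_one_add' hN'.le (by linarith)]; congr 1; ring
  rw [norm_mul, Real.norm_of_nonneg hN'.le, e, mul_assoc]
  refine mul_le_mul_of_nonneg_left ?_ hN'.le
  rw [← mul_assoc, ← integral_const_mul]
  refine norm_integral_le_of_norm_le (hf.norm.const_mul _) ?_
  refine (ae_restrict_mem hs).mono fun w hw => ?_
  have hw' := Real.rpow_pos_of_pos (hs0 hw) (-α)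
  have hNp := Real.rpow_pos_of_pos hN' (-(α / β))
  rw [norm_mul, norm_mul, Real.norm_of_nonneg hw'.le]
  calc _ ≤ ((N : ℝ) ^ (-(α / β)) * w ^ (-α) * r) * ‖f w‖ :=
        mul_le_mul_of_nonneg_right (abs_exp_neg_sub_one_le (by positivity)) (norm_nonneg _)
    _ = _ := by ring

theorem tendsto_nat_mul_integral_Ioc_exp_neg_sub_one_mul {α β r ψ₁ : ℝ}
    (hβ : 0 < β) (hβα : β < α) (hr : 0 < r) {χ : ℝ → ℝ}
    (hχi : IntegrableOn χ (Ioc 0 1))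
    (hχ : Tendsto χ (nhdsWithin 0 (Ioi 0)) (nhds ψ₁)) :
    Tendsto (fun N : ℕ => (N : ℝ) * ∫ w in Ioc (0 : ℝ) 1,
        (Real.exp (-((N : ℝ) ^ (-(α / β)) * w ^ (-α) * r)) - 1) * (χ w * w ^ (β - 1)))
      atTop (nhds (-(ψ₁ * Real.Gamma (1 - β / α) / β) * r ^ (β / α))) := by
  have hev : ∀ᶠ w in nhdsWithin (0 : ℝ) (Ioi 0), |χ w| ≤ |ψ₁| + 1 :=
    (hχ.abs.eventually_lt_const (lt_add_one _)).mono fun _ h => h.le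
  obtain ⟨ε, hε, hεχ⟩ := mem_nhdsGT_iff_exists_Ioc_subset.1 hev
  have hε : 0 < ε := hε
  obtain ⟨δ, hδ0, hδ1, hδχ⟩ : ∃ δ : ℝ, 0 < δ ∧ δ ≤ 1 ∧ ∀ w ∈ Ioc 0 δ, |χ w| ≤ |ψ₁| + 1 :=
    ⟨min ε 1, lt_min hε one_pos, min_le_right _ _,
      fun w hw => hεχ ⟨hw.1, hw.2.trans (min_le_left _ _)⟩⟩
  have hnear : IntegrableOn (fun w => χ w * w ^ (β - 1)) (Ioc 0 δ) := by
    have h := (intervalIntegral.intervalIntegrable_rpow' (r := β - 1) (a := 0) (b := δ)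
      (by linarith))
    rw [intervalIntegrable_iff_integrableOn_Ioc_of_le hδ0.le] at h
    refine h.bdd_mul (c := |ψ₁| + 1)
      (hχi.mono_set (Ioc_subset_Ioc_right hδ1)).aestronglyMeasurable ?_
    exact (ae_restrict_mem measurableSet_Ioc).mono hδχ
  have hfar : ∀ p : ℝ, IntegrableOn (fun w => χ w * w ^ p) (Ioc δ 1) := fun p =>
    (hχi.mono_set (Ioc_subset_Ioc_left hδ0.le)).mul_continuousOn_of_subset
      (K := Icc δ 1)
      (fun w hw => (Real.continuousAt_rpow_const w p
        (Or.inl (hδ0.trans_le hw.1).ne')).continuousWithinAt)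
      measurableSet_Ioc isCompact_Icc Ioc_subset_Icc_self
  have hsub : Ioc δ 1 ⊆ Ioi (0 : ℝ) := fun w hw => hδ0.trans hw.1
  have hmul : ∀ w : ℝ, (Ioc 0 δ).indicator χ w * w ^ (β - 1) =
      (Ioc 0 δ).indicator (fun w => χ w * w ^ (β - 1)) w := fun w =>
    (indicator_mul_left (Ioc 0 δ) χ fun w => w ^ (β - 1)).symm
  have h1 := tendsto_nat_mul_integral_exp_neg_sub_one_mul_of_bounded (C := |ψ₁| + 1)
    (G := (Ioc 0 δ).indicator χ) (ψ₁ := ψ₁) hβ hβα hr ?_ ?_ ?_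
  · have h2 := tendsto_nat_mul_integral_exp_neg_sub_one_mul_zero hβ hβα hr
      (f := fun w => χ w * w ^ (β - 1)) (s := Ioc δ 1) measurableSet_Ioc hsub ?_
    · have h3 := h1.add h2
      rw [add_zero] at h3
      refine h3.congr fun N => ?_
      have hN := Real.rpow_nonneg (Nat.cast_nonneg (α := ℝ) N) (-(α / β))
      rw [← mul_add, ← Ioc_union_Ioc_eq_Ioc hδ0.le hδ1,
        setIntegral_union (Ioc_disjoint_Ioc_of_le le_rfl) measurableSet_Ioc
          (integrableOn_exp_neg_mul_rpow_sub_one_mul hN hr.le measurableSet_Ioc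
            Ioc_subset_Ioi_self hnear)
          (integrableOn_exp_neg_mul_rpow_sub_one_mul hN hr.le measurableSet_Ioc hsub
            (hfar _))]
      congr 2
      simp_rw [hmul]
      simp only [← indicator_mul_right (Ioc 0 δ) (fun w : ℝ =>
        Real.exp (-((N : ℝ) ^ (-(α / β)) * w ^ (-α) * r)) - 1)]
      rw [setIntegral_indicator measurableSet_Ioc,
        inter_eq_right.2 Ioc_subset_Ioi_self]
    · refine (hfar (β - 1 + -α)).congr_fun (fun w hw => ?_) measurableSet_Ioc
      simp only [Real.rpow_add (hsub hw), mul_assoc]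
  · intro w _
    by_cases hw : w ∈ Ioc 0 δ
    · rw [indicator_of_mem hw]; exact hδχ w hw
    · rw [indicator_of_notMem hw, abs_zero]; positivity
  · refine hχ.congr' ?_
    filter_upwards [Ioc_mem_nhdsGT hδ0] with w hw
    rw [indicator_of_mem hw]
  · simp_rw [hmul]
    exact ((integrable_indicator_iff measurableSet_Ioc).2 hnear).integrableOn

/-- the convergence (4.9)–(4.10) of characteristic exponents proving the
iterated limit (2.14) of Theorem 2.1, with limiting constant
`κ_{β/α,α,β} = (ψ₁/β)Γ(1−β/α)`. -/
theorem stmt_9 (α β : ℝ) (hβ0 : 0 < β) (hβα : β < α) (hα2 : α ≤ 2)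
    (ψ : ℝ → ℝ) (ψ₁ : ℝ) (hψ₁ : 0 < ψ₁)
    (hψint : MeasureTheory.IntegrableOn ψ (Set.Ico 0 1))
    (hψnn : ∀ u ∈ Set.Ico (0:ℝ) 1, 0 ≤ ψ u)
    (hψlim : Filter.Tendsto ψ (nhdsWithin 1 (Set.Iio 1)) (nhds ψ₁))
    (r : ℝ) (hr : 0 < r) :
    Filter.Tendsto (fun N : ℕ =>
        (N : ℝ) * ∫ u in Set.Ico (0:ℝ) 1,
          (Real.exp (-((N : ℝ) ^ (-(α / β)) * (1 - u) ^ (-α) * r)) - 1)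
            * (ψ u * (1 - u) ^ (β - 1)))
      Filter.atTop
      (nhds (-(ψ₁ * Real.Gamma (1 - β / α) / β) * r ^ (β / α))) := by
  have hi : IntegrableOn (fun w => ψ (1 - w)) (Ioc 0 1) := by
    have h : IntervalIntegrable ψ volume 0 1 := by
      rw [intervalIntegrable_iff_integrableOn_Ico_of_le zero_le_one]
      exact hψint
    have h' := (h.comp_sub_left 1).symm
    rw [sub_self, sub_zero] at h'
    rwa [intervalIntegrable_iff_integrableOn_Ioc_of_le zero_le_one] at h'
  have hl : Tendsto (fun w => ψ (1 - w)) (nhdsWithin 0 (Ioi 0)) (nhds ψ₁) := by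
    refine hψlim.comp (tendsto_nhdsWithin_iff.2 ⟨?_, ?_⟩)
    · have : Tendsto (fun w : ℝ => 1 - w) (nhds 0) (nhds (1 - 0)) :=
        (continuous_const.sub continuous_id).tendsto 0
      rw [sub_zero] at this
      exact this.mono_left nhdsWithin_le_nhds
    · exact eventually_nhdsWithin_of_forall fun w hw => mem_Iio.2 (sub_lt_self (1 : ℝ) hw)
  refine (tendsto_nat_mul_integral_Ioc_exp_neg_sub_one_mul hβ0 hβα hr hi hl).congr fun N => ?_
  have h := intervalIntegral.integral_comp_sub_left (a := 0) (b := 1)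
    (fun u => (Real.exp (-((N : ℝ) ^ (-(α / β)) * (1 - u) ^ (-α) * r)) - 1)
            * (ψ u * (1 - u) ^ (β - 1))) 1
  simp only [sub_sub_cancel, sub_self, sub_zero] at h
  rw [intervalIntegral.integral_of_le zero_le_one,
    intervalIntegral.integral_of_le zero_le_one] at h
  rw [h, integral_Ico_eq_integral_Ioc]
end

section
/- Let 1 < β < α ≤ 2, τ > 0 and r > 0. Then ∫_0^∞ ∫_ℝ |f_τ(x,s)|^α ds · x^{β−1} dx < ∞, and lim_{c→0} c^{−β} ∫_0^∞ (exp(−c^β r ∫_ℝ |f_τ(x,s)|^α ds) − 1) x^{β−1} dx = −r ∫_0^∞ ∫_ℝ |f_τ(x,s)|^α ds · x^{β−1} dx. -/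
open MeasureTheory Filter Set

lemma fker_nonneg (τ x s : ℝ) : 0 ≤ fker τ x s := by
  refine setIntegral_nonneg measurableSet_Ioc fun t _ => ?_
  split_ifs <;> positivity

lemma fker_eq_zero_of_lt {τ s : ℝ} (x : ℝ) (h : τ < s) : fker τ x s = 0 := by
  refine setIntegral_eq_zero_of_forall_eq_zero fun t ht => if_neg ?_
  linarith [ht.2]

lemma fker_eq_exp_mul {s : ℝ} (τ x : ℝ) (hs : s ≤ 0) :
    fker τ x s = Real.exp (x * s) * fker τ x 0 := by
  unfold fker
  rw [← integral_const_mul]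
  refine setIntegral_congr_fun measurableSet_Ioc fun t ht => ?_
  simp only [if_pos (hs.trans ht.1.le), if_pos ht.1.le, ← Real.exp_add]
  congr 1
  ring

lemma fker_le_length {τ x : ℝ} (hτ : 0 ≤ τ) (hx : 0 ≤ x) (s : ℝ) : fker τ x s ≤ τ := by
  have h : fker τ x s ≤ ∫ _ in Ioc (0 : ℝ) τ, (1 : ℝ) := by
    refine integral_mono_of_nonneg (ae_of_all _ fun t => ?_) (by simp)
      (ae_of_all _ fun t => ?_)
    · dsimp only
      split_ifs
      · positivity
      · simp
    · dsimp only
      split_ifs with hst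
      · exact Real.exp_le_one_iff.2 (by nlinarith)
      · exact zero_le_one
  simpa [hτ] using h

lemma fker_le_inv {x : ℝ} (hx : 0 < x) (τ s : ℝ) : fker τ x s ≤ x⁻¹ := by
  have hint : IntegrableOn (fun t => Real.exp (x * s) * Real.exp (-x * t)) (Ioi s) :=
    (integrableOn_exp_mul_Ioi (neg_lt_zero.2 hx) s).const_mul _
  have hval : ∫ t in Ici s, Real.exp (x * s) * Real.exp (-x * t) = x⁻¹ := by
    rw [integral_Ici_eq_integral_Ioi, integral_const_mul,
      integral_exp_mul_Ioi (neg_lt_zero.2 hx), neg_div_neg_eq, ← mul_div_assoc, ← Real.exp_add]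
    simp
  have hint' := ((integrableOn_Ici_iff_integrableOn_Ioi).2 hint).integrable_indicator
    measurableSet_Ici
  rw [← hval, ← integral_indicator measurableSet_Ici]
  have hnn : 0 ≤ (Ici s).indicator (fun t => Real.exp (x * s) * Real.exp (-x * t)) :=
    indicator_nonneg fun t _ => by positivity
  refine le_trans (le_of_eq ?_) (setIntegral_le_integral (s := Ioc 0 τ) hint'
    (ae_of_all _ hnn))
  refine setIntegral_congr_fun measurableSet_Ioc fun t _ => ?_
  by_cases h : s ≤ t
  · simp only [if_pos h, indicator_of_mem (mem_Ici.2 h), ← Real.exp_add]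
    congr 1
    ring
  · simp [h]

lemma stronglyMeasurable_fker (τ : ℝ) :
    StronglyMeasurable (fun p : ℝ × ℝ => fker τ p.1 p.2) := by
  have h : Measurable (fun q : (ℝ × ℝ) × ℝ =>
      if q.1.2 ≤ q.2 then Real.exp (-q.1.1 * (q.2 - q.1.2)) else 0) :=
    Measurable.ite (measurableSet_le (by fun_prop) (by fun_prop)) (by fun_prop) (by fun_prop)
  exact h.stronglyMeasurable.integral_prod_right'

lemma stronglyMeasurable_integral_fker_rpow (τ α : ℝ) :
    StronglyMeasurable (fun x : ℝ => ∫ s : ℝ, |fker τ x s| ^ α) := by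
  have h : Measurable (fun p : ℝ × ℝ => |fker τ p.1 p.2| ^ α) :=
    ((stronglyMeasurable_fker τ).measurable.norm).pow_const α
  exact h.stronglyMeasurable.integral_prod_right'

lemma integral_fker_rpow_nonneg (τ α x : ℝ) : 0 ≤ ∫ s : ℝ, |fker τ x s| ^ α :=
  integral_nonneg fun _ => by positivity

lemma integral_fker_rpow_le {τ α x M : ℝ} (hτ : 0 ≤ τ) (hα : 0 < α) (hx : 0 < x)
    (hM : ∀ s, fker τ x s ≤ M) :
    ∫ s : ℝ, |fker τ x s| ^ α ≤ M ^ α * ((α * x)⁻¹ + τ) := by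
  have hM0 : 0 ≤ M := (fker_nonneg τ x 0).trans (hM 0)
  have h1 : Integrable ((Iic (0 : ℝ)).indicator fun s => Real.exp (α * x * s)) :=
    (integrableOn_exp_mul_Iic (by positivity) 0).integrable_indicator measurableSet_Iic
  have h2 : Integrable ((Ioc (0 : ℝ) τ).indicator fun _ => (1 : ℝ)) :=
    (integrableOn_const (by simp)).integrable_indicator measurableSet_Ioc
  have hval : ∫ s, M ^ α * ((Iic (0 : ℝ)).indicator (fun s => Real.exp (α * x * s)) s
      + (Ioc (0 : ℝ) τ).indicator (fun _ => (1 : ℝ)) s) = M ^ α * ((α * x)⁻¹ + τ) := by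
    rw [integral_const_mul, integral_add h1 h2, integral_indicator measurableSet_Iic,
      integral_indicator measurableSet_Ioc, integral_exp_mul_Iic (by positivity)]
    simp [hτ]
  rw [← hval]
  refine integral_mono_of_nonneg (ae_of_all _ fun s => by positivity)
    ((h1.add h2).const_mul _) (ae_of_all _ fun s => ?_)
  dsimp only
  rw [abs_of_nonneg (fker_nonneg τ x s)]
  rcases le_or_gt s 0 with hs | hs
  · rw [fker_eq_exp_mul τ x hs, Real.mul_rpow (Real.exp_pos _).le (fker_nonneg τ x 0),
      ← Real.exp_mul, mul_comm]
    have : s ∉ Ioc 0 τ := fun h => absurd h.1 (not_lt.2 hs)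
    rw [indicator_of_mem (mem_Iic.2 hs), indicator_of_notMem this, add_zero,
      show x * s * α = α * x * s by ring]
    gcongr
    · exact fker_nonneg τ x 0
    · exact hM 0
  · rw [indicator_of_notMem (s := Iic 0) (by simpa using hs), zero_add]
    rcases le_or_gt s τ with hsτ | hsτ
    · rw [indicator_of_mem (show s ∈ Ioc 0 τ from ⟨hs, hsτ⟩), mul_one]
      exact Real.rpow_le_rpow (fker_nonneg τ x s) (hM s) hα.le
    · rw [fker_eq_zero_of_lt x hsτ, Real.zero_rpow hα.ne']
      exact mul_nonneg (by positivity) (indicator_nonneg (fun _ _ => zero_le_one) _)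

lemma integrableOn_integral_fker_rpow {α β τ : ℝ} (hβ1 : 1 < β) (hβα : β < α) (hτ : 0 ≤ τ) :
    IntegrableOn (fun x : ℝ => (∫ s : ℝ, |fker τ x s| ^ α) * x ^ (β - 1)) (Ioi 0) := by
  have hα : 0 < α := by linarith
  have hmeas : Measurable fun x : ℝ => (∫ s : ℝ, |fker τ x s| ^ α) * x ^ (β - 1) :=
    (stronglyMeasurable_integral_fker_rpow τ α).measurable.mul (measurable_id.pow_const _)
  have hbound {x M : ℝ} (hx : 0 < x) (hM : ∀ s, fker τ x s ≤ M) :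
      ‖(∫ s : ℝ, |fker τ x s| ^ α) * x ^ (β - 1)‖
        ≤ M ^ α * (α⁻¹ * x ^ (β - 2) + τ * x ^ (β - 1)) := by
    have h0 := integral_fker_rpow_nonneg τ α x
    rw [Real.norm_of_nonneg (by positivity)]
    calc _ ≤ M ^ α * ((α * x)⁻¹ + τ) * x ^ (β - 1) := by
          gcongr
          exact integral_fker_rpow_le hτ hα hx hM
      _ = _ := by
          rw [show β - 1 = (β - 2) + 1 by ring, Real.rpow_add_one hx.ne']
          field_simp
  rw [← Ioc_union_Ioi_eq_Ioi zero_le_one]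
  refine IntegrableOn.union ?_ ?_
  · have hrpow {p : ℝ} (hp : -1 < p) : IntegrableOn (fun x : ℝ => x ^ p) (Ioc 0 1) :=
      (intervalIntegrable_iff_integrableOn_Ioc_of_le zero_le_one).1
        (intervalIntegral.intervalIntegrable_rpow' hp)
    have hg : IntegrableOn
        (fun x : ℝ => τ ^ α * (α⁻¹ * x ^ (β - 2) + τ * x ^ (β - 1))) (Ioc 0 1) :=
      Integrable.const_mul (Integrable.add ((hrpow (by linarith)).const_mul _)
        ((hrpow (by linarith)).const_mul _)) _
    refine Integrable.mono' hg hmeas.aestronglyMeasurable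
      ((ae_restrict_iff' measurableSet_Ioc).2 (ae_of_all _ fun x hx => ?_))
    exact hbound hx.1 (fker_le_length hτ hx.1.le)
  · have hg : IntegrableOn
        (fun x : ℝ => α⁻¹ * x ^ (β - 2 - α) + τ * x ^ (β - 1 - α)) (Ioi 1) :=
      Integrable.add
        ((integrableOn_Ioi_rpow_of_lt (by linarith) one_pos).const_mul _)
        ((integrableOn_Ioi_rpow_of_lt (by linarith) one_pos).const_mul _)
    refine Integrable.mono' hg hmeas.aestronglyMeasurable
      ((ae_restrict_iff' measurableSet_Ioi).2 (ae_of_all _ fun x hx => ?_))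
    have hx0 : 0 < x := one_pos.trans hx
    refine (hbound hx0 (fker_le_inv hx0 τ)).trans_eq ?_
    rw [Real.rpow_sub hx0 (β - 2), Real.rpow_sub hx0 (β - 1), Real.inv_rpow hx0.le]
    ring

lemma tendsto_inv_mul_exp_neg_mul_sub_one (a : ℝ) :
    Tendsto (fun u : ℝ => u⁻¹ * (Real.exp (-(u * a)) - 1)) (nhdsWithin 0 (Ioi 0))
      (nhds (-a)) := by
  have h : HasDerivAt (fun u : ℝ => Real.exp (-(u * a))) (-a) 0 := by
    simpa using ((hasDerivAt_id (0 : ℝ)).mul_const a).neg.exp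
  simpa using h.tendsto_slope_zero_right

lemma abs_inv_mul_exp_neg_mul_sub_one_le {u a : ℝ} (hu : 0 < u) (ha : 0 ≤ a) :
    |u⁻¹ * (Real.exp (-(u * a)) - 1)| ≤ a := by
  have h1 : Real.exp (-(u * a)) ≤ 1 := Real.exp_le_one_iff.2 (by nlinarith)
  have h2 := Real.one_sub_le_exp_neg (u * a)
  rw [abs_mul, abs_of_pos (inv_pos.2 hu), abs_of_nonpos (by linarith), inv_mul_le_iff₀ hu]
  linarith

theorem tendsto_inv_mul_integral_exp_neg_sub_one {X : Type*} [MeasurableSpace X]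
    {μ : Measure X} {g w : X → ℝ} (hg : AEStronglyMeasurable g μ)
    (hw : AEStronglyMeasurable w μ) (hg0 : ∀ x, 0 ≤ g x)
    (hgw : Integrable (fun x => g x * w x) μ) :
    Tendsto (fun u : ℝ => u⁻¹ * ∫ x, (Real.exp (-(u * g x)) - 1) * w x ∂μ)
      (nhdsWithin 0 (Ioi 0)) (nhds (-∫ x, g x * w x ∂μ)) := by
  rw [← integral_neg]
  simp_rw [← integral_const_mul, ← mul_assoc, ← neg_mul (g _)]
  refine tendsto_integral_filter_of_dominated_convergence (fun x => ‖g x * w x‖)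
    (Eventually.of_forall fun u => ?_) ?_ hgw.norm (ae_of_all _ fun x => ?_)
  · exact (((Real.continuous_exp.comp_aestronglyMeasurable
      (hg.const_mul u).neg).sub aestronglyMeasurable_const).const_mul _).mul hw
  · filter_upwards [self_mem_nhdsWithin] with u hu
    refine ae_of_all _ fun x => ?_
    rw [norm_mul, norm_mul (g x), Real.norm_of_nonneg (hg0 x)]
    gcongr
    exact abs_inv_mul_exp_neg_mul_sub_one_le hu (hg0 x)
  · exact (tendsto_inv_mul_exp_neg_mul_sub_one (g x)).mul_const _

/-- the small-scale asymptotic self-similarity limit of `Z_{α,β}`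
towards the α-stable self-similar process `Λ_{α,β}` (Proposition 3.1(v),
case `1 < β < α`), at the level of characteristic exponents with `ω ≡ 1`. -/
theorem stmt_12 (α β τ r : ℝ) (hβ1 : 1 < β) (hβα : β < α) (hα2 : α ≤ 2)
    (hτ : 0 < τ) (hr : 0 < r) :
    MeasureTheory.IntegrableOn
      (fun x : ℝ => (∫ s : ℝ, |fker τ x s| ^ α) * x ^ (β - 1)) (Set.Ioi 0) ∧
    Filter.Tendsto (fun c : ℝ =>
        c ^ (-β) * ∫ x in Set.Ioi (0:ℝ),
          (Real.exp (-(c ^ β * r * ∫ s : ℝ, |fker τ x s| ^ α)) - 1) * x ^ (β - 1))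
      (nhdsWithin 0 (Set.Ioi 0))
      (nhds (-r * ∫ x in Set.Ioi (0:ℝ), (∫ s : ℝ, |fker τ x s| ^ α) * x ^ (β - 1))) := by
  have hint := integrableOn_integral_fker_rpow hβ1 hβα hτ.le
  refine ⟨hint, ?_⟩
  have hβ : 0 < β := by linarith
  have hpow : Tendsto (fun c : ℝ => c ^ β) (nhdsWithin 0 (Ioi 0)) (nhdsWithin 0 (Ioi 0)) := by
    refine tendsto_nhdsWithin_iff.2 ⟨?_, ?_⟩
    · have h := (Real.continuousAt_rpow_const 0 β (Or.inr hβ.le)).tendsto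
      rw [Real.zero_rpow hβ.ne'] at h
      exact h.mono_left nhdsWithin_le_nhds
    · filter_upwards [self_mem_nhdsWithin] with c hc using Real.rpow_pos_of_pos hc β
  have hlim := (tendsto_inv_mul_integral_exp_neg_sub_one
    (μ := volume.restrict (Ioi (0 : ℝ))) (w := fun x => x ^ (β - 1))
    ((stronglyMeasurable_integral_fker_rpow τ α).aestronglyMeasurable.const_mul r)
    (measurable_id.pow_const (β - 1)).aestronglyMeasurable
    (fun x => mul_nonneg hr.le (integral_fker_rpow_nonneg τ α x))
    (by simpa only [mul_assoc] using hint.const_mul r)).comp hpow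
  simp only [mul_assoc, integral_const_mul, ← neg_mul] at hlim
  refine hlim.congr' ?_
  filter_upwards [self_mem_nhdsWithin] with c hc
  simp only [Function.comp_apply, Real.rpow_neg (le_of_lt hc), mul_assoc, neg_mul]
end
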